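/- arXiv:2406.02317 — 2 statements merged into one kernel-verified Lean document; each statement's English description precedes it below -/
import Mathlib

section
/- For probability measures μ, ν on ℝ with finite second moments and ε > 0, the entropic optimal transport problem min over couplings π of ∫ |y−y′|² dπ − ε H(π) admits a unique minimizer, where H denotes the entropy of π relative to the product measure μ ⊗ ν. -/
open MeasureTheory Set

/-- `π` is a coupling of `μ` and `ν`. -/
def IsCoupling (π : Measure (ℝ × ℝ)) (μ ν : Measure ℝ) : Prop :=
  π.map Prod.fst = μ ∧ π.map Prod.snd = ν

/-- The relative entropy (KL divergence) of `π` with respect to `ρ`,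
i.e. the negative of the entropy `H(π)` of the paper. -/
noncomputable def relEnt (π ρ : Measure (ℝ × ℝ)) : ℝ := ∫ p, llr π ρ p ∂π

/-- The entropic optimal transport objective `∫ |y - y'|² dπ - ε H(π)`
(where `H(π) = -relEnt π (μ ⊗ ν)`). -/
noncomputable def eotObj (μ ν : Measure ℝ) (ε : ℝ) (π : Measure (ℝ × ℝ)) : ℝ :=
  ∫ p, (p.1 - p.2) ^ 2 ∂π + ε * relEnt π (μ.prod ν)

/-- A coupling is admissible if it has finite relative entropy w.r.t. `μ ⊗ ν`
(otherwise `H(π) = -∞` and the objective is `+∞`). -/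
def Admissible (π : Measure (ℝ × ℝ)) (μ ν : Measure ℝ) : Prop :=
  IsCoupling π μ ν ∧ π ≪ μ.prod ν ∧ Integrable (llr π (μ.prod ν)) π

open InformationTheory Filter Topology

open scoped ENNReal NNReal

lemma mul_log_tangent_le {a m : ℝ} (ha : 0 ≤ a) (hm : 0 < m) :
    a * Real.log m + 2 * a - 2 * (√a * √m) ≤ a * Real.log a := by
  rcases ha.eq_or_lt with rfl | ha
  · simp
  have hsa := Real.sqrt_pos.2 ha
  have hsm := Real.sqrt_pos.2 hm
  have hlog := Real.log_le_sub_one_of_pos (div_pos hsm hsa)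
  rw [Real.log_div hsm.ne' hsa.ne', Real.log_sqrt hm.le, Real.log_sqrt ha.le] at hlog
  have h := mul_le_mul_of_nonneg_left hlog ha.le
  have hdiv : a * (√m / √a) = √a * √m := by
    rw [mul_div_assoc', div_eq_iff hsa.ne']
    nlinarith [Real.mul_self_sqrt ha.le]
  nlinarith

/-- A quantitative form of the convexity of `klFun`: the midpoint convexity gap controls the
squared Hellinger distance. -/
lemma klFun_midpoint_add_sq_le {a b : ℝ} (ha : 0 ≤ a) (hb : 0 ≤ b) :
    klFun ((a + b) / 2) + (√a - √b) ^ 2 / 4 ≤ (klFun a + klFun b) / 2 := by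
  rcases (show 0 ≤ (a + b) / 2 by positivity).eq_or_lt with h | hm
  · obtain rfl : a = 0 := by linarith
    obtain rfl : b = 0 := by linarith
    simp
  have h1 := mul_log_tangent_le ha hm
  have h2 := mul_log_tangent_le hb hm
  set r := √((a + b) / 2)
  have hr : r ^ 2 = (a + b) / 2 := Real.sq_sqrt hm.le
  have hsa := Real.sq_sqrt ha
  have hsb := Real.sq_sqrt hb
  simp only [klFun]
  nlinarith [sq_nonneg (r - (√a + √b) / 2)]

lemma eLpNorm_two_sq {α : Type*} [MeasurableSpace α] (κ : Measure α) (h : α → ℝ) :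
    eLpNorm h 2 κ ^ 2 = ∫⁻ x, ENNReal.ofReal (h x ^ 2) ∂κ := by
  have := eLpNorm_nnreal_pow_eq_lintegral (μ := κ) (f := h) (p := 2) two_ne_zero
  simp only [NNReal.coe_ofNat, ENNReal.rpow_ofNat, ENNReal.coe_ofNat] at this
  rw [this]
  refine lintegral_congr fun x => ?_
  rw [← sq_abs, ENNReal.ofReal_pow (abs_nonneg _), ← Real.norm_eq_abs, ofReal_norm]

lemma lintegral_sq_eq_of_tendsto_eLpNorm {α : Type*} [MeasurableSpace α] {κ : Measure α}
    {h : ℕ → α → ℝ} {g : α → ℝ} {C : ℝ≥0∞}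
    (hm : ∀ n, AEStronglyMeasurable (h n) κ) (gm : AEStronglyMeasurable g κ)
    (hC : ∀ n, ∫⁻ x, ENNReal.ofReal (h n x ^ 2) ∂κ = C)
    (hlim : Tendsto (fun n => eLpNorm (h n - g) 2 κ) atTop (𝓝 0)) :
    ∫⁻ x, ENNReal.ofReal (g x ^ 2) ∂κ = C := by
  have hconst (n : ℕ) : eLpNorm (h n) 2 κ = eLpNorm (h 0) 2 κ :=
    (ENNReal.pow_right_strictMono two_ne_zero).injective (by simp only [eLpNorm_two_sq, hC])
  rw [← hC 0, ← eLpNorm_two_sq, ← eLpNorm_two_sq]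
  congr 1
  apply le_antisymm
  · refine le_of_tendsto_of_tendsto' (f := fun _ : ℕ => _) tendsto_const_nhds
      (by simpa using hlim.const_add (eLpNorm (h 0) 2 κ)) fun n => ?_
    calc eLpNorm g 2 κ = eLpNorm (h n - (h n - g)) 2 κ := by rw [sub_sub_cancel]
      _ ≤ eLpNorm (h n) 2 κ + eLpNorm (h n - g) 2 κ :=
        eLpNorm_sub_le (hm n) ((hm n).sub gm) one_le_two
      _ = _ := by rw [hconst n]
  · refine le_of_tendsto_of_tendsto' (f := fun _ : ℕ => _) tendsto_const_nhds
      (by simpa using hlim.const_add (eLpNorm g 2 κ)) fun n => ?_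
    calc eLpNorm (h 0) 2 κ = eLpNorm (g + (h n - g)) 2 κ := by rw [add_sub_cancel, hconst n]
      _ ≤ eLpNorm g 2 κ + eLpNorm (h n - g) 2 κ :=
        eLpNorm_add_le gm ((hm n).sub gm) one_le_two

lemma IsCoupling.isProbabilityMeasure {π : Measure (ℝ × ℝ)} {μ ν : Measure ℝ}
    [IsProbabilityMeasure μ] (h : IsCoupling π μ ν) : IsProbabilityMeasure π := by
  refine ⟨?_⟩
  rw [← measure_univ (μ := μ), ← h.1, Measure.map_apply measurable_fst .univ, preimage_univ]

lemma isCoupling_iff {π : Measure (ℝ × ℝ)} {μ ν : Measure ℝ} :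
    IsCoupling π μ ν ↔ (∀ A, MeasurableSet A → π (Prod.fst ⁻¹' A) = μ A) ∧
      ∀ A, MeasurableSet A → π (Prod.snd ⁻¹' A) = ν A := by
  refine and_congr ⟨?_, fun h => ?_⟩ ⟨?_, fun h => ?_⟩
  · rintro rfl A hA
    rw [Measure.map_apply measurable_fst hA]
  · ext A hA
    rw [Measure.map_apply measurable_fst hA, h A hA]
  · rintro rfl A hA
    rw [Measure.map_apply measurable_snd hA]
  · ext A hA
    rw [Measure.map_apply measurable_snd hA, h A hA]

lemma IsCoupling.integrable_sq_sub {π : Measure (ℝ × ℝ)} {μ ν : Measure ℝ}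
    (h : IsCoupling π μ ν)
    (hμ2 : Integrable (fun y => y ^ 2) μ) (hν2 : Integrable (fun y => y ^ 2) ν) :
    Integrable (fun p : ℝ × ℝ => (p.1 - p.2) ^ 2) π := by
  have h1 : Integrable (fun p : ℝ × ℝ => p.1 ^ 2) π :=
    (h.1.symm ▸ hμ2 : Integrable (fun y => y ^ 2) (π.map Prod.fst)).comp_measurable measurable_fst
  have h2 : Integrable (fun p : ℝ × ℝ => p.2 ^ 2) π :=
    (h.2.symm ▸ hν2 : Integrable (fun y => y ^ 2) (π.map Prod.snd)).comp_measurable measurable_snd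
  refine ((h1.const_mul 2).add (h2.const_mul 2)).mono' (by fun_prop) (.of_forall fun p => ?_)
  rw [Real.norm_of_nonneg (sq_nonneg _)]
  simp only [Pi.add_apply]
  nlinarith [sq_nonneg (p.1 + p.2)]

/-- The measure with density `f` with respect to `μ ⊗ ν`. -/
noncomputable def densityMeasure (μ ν : Measure ℝ) (f : ℝ × ℝ → ℝ) : Measure (ℝ × ℝ) :=
  (μ.prod ν).withDensity fun p => ENNReal.ofReal (f p)

/-- Densities with respect to `μ ⊗ ν` of the couplings of finite relative entropy. -/
structure IsAdmissibleDensity (μ ν : Measure ℝ) (f : ℝ × ℝ → ℝ) : Prop where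
  measurable : Measurable f
  nonneg : ∀ p, 0 ≤ f p
  isCoupling : IsCoupling (densityMeasure μ ν f) μ ν
  integrable_klFun : Integrable (fun p => klFun (f p)) (μ.prod ν)

/-- The entropic optimal transport objective in terms of densities. -/
noncomputable def densityObj (μ ν : Measure ℝ) (ε : ℝ) (f : ℝ × ℝ → ℝ) : ℝ :=
  ∫ p, (f p * (p.1 - p.2) ^ 2 + ε * klFun (f p)) ∂(μ.prod ν)

section

variable {μ ν : Measure ℝ}

namespace IsAdmissibleDensity

variable {f g : ℝ × ℝ → ℝ}

lemma integrable_cost (hf : IsAdmissibleDensity μ ν f)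
    (hμ2 : Integrable (fun y => y ^ 2) μ) (hν2 : Integrable (fun y => y ^ 2) ν) :
    Integrable (fun p => f p * (p.1 - p.2) ^ 2) (μ.prod ν) := by
  have h := hf.isCoupling.integrable_sq_sub hμ2 hν2
  rw [densityMeasure,
    integrable_withDensity_iff_integrable_smul₀' hf.measurable.ennreal_ofReal.aemeasurable
    (.of_forall fun _ => ENNReal.ofReal_lt_top)] at h
  refine h.congr (.of_forall fun p => ?_)
  simp [ENNReal.toReal_ofReal (hf.nonneg p)]

lemma densityObj_nonneg (hf : IsAdmissibleDensity μ ν f) {ε : ℝ} (hε : 0 < ε) :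
    0 ≤ densityObj μ ν ε f :=
  integral_nonneg fun p => add_nonneg (mul_nonneg (hf.nonneg p) (sq_nonneg _))
    (mul_nonneg hε.le (klFun_nonneg (hf.nonneg p)))

lemma densityMeasure_midpoint_apply (hf : IsAdmissibleDensity μ ν f)
    (hg : IsAdmissibleDensity μ ν g) {A : Set (ℝ × ℝ)} (hA : MeasurableSet A) :
    densityMeasure μ ν (fun p => (f p + g p) / 2) A
      = (densityMeasure μ ν f A + densityMeasure μ ν g A) / 2 := by
  have hfm := hf.measurable
  have hgm := hg.measurable
  simp only [densityMeasure, withDensity_apply _ hA]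
  rw [← lintegral_add_left (by fun_prop), div_eq_mul_inv, ← lintegral_mul_const _ (by fun_prop)]
  refine lintegral_congr fun p => ?_
  rw [← ENNReal.ofReal_add (hf.nonneg p) (hg.nonneg p), ENNReal.ofReal_div_of_pos two_pos,
    ENNReal.ofReal_ofNat, div_eq_mul_inv]

lemma integrable_obj (hf : IsAdmissibleDensity μ ν f)
    (hμ2 : Integrable (fun y => y ^ 2) μ) (hν2 : Integrable (fun y => y ^ 2) ν) (ε : ℝ) :
    Integrable (fun p => f p * (p.1 - p.2) ^ 2 + ε * klFun (f p)) (μ.prod ν) :=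
  (hf.integrable_cost hμ2 hν2).add (hf.integrable_klFun.const_mul ε)

lemma midpoint (hf : IsAdmissibleDensity μ ν f) (hg : IsAdmissibleDensity μ ν g) :
    IsAdmissibleDensity μ ν fun p => (f p + g p) / 2 := by
  have hfm := hf.measurable
  have hgm := hg.measurable
  have hhalf (x : ℝ≥0∞) : (x + x) / 2 = x := by rw [ENNReal.add_div, ENNReal.add_halves]
  refine ⟨by fun_prop, fun p => ?_, isCoupling_iff.2 ⟨fun A hA => ?_, fun A hA => ?_⟩, ?_⟩
  · have := hf.nonneg p
    have := hg.nonneg p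
    positivity
  · rw [densityMeasure_midpoint_apply hf hg (measurable_fst hA),
      (isCoupling_iff.1 hf.isCoupling).1 A hA, (isCoupling_iff.1 hg.isCoupling).1 A hA, hhalf]
  · rw [densityMeasure_midpoint_apply hf hg (measurable_snd hA),
      (isCoupling_iff.1 hf.isCoupling).2 A hA, (isCoupling_iff.1 hg.isCoupling).2 A hA, hhalf]
  · refine ((hf.integrable_klFun.add hg.integrable_klFun).div_const 2).mono'
      (measurable_klFun.comp (by fun_prop)).aestronglyMeasurable (.of_forall fun p => ?_)
    have := klFun_midpoint_add_sq_le (hf.nonneg p) (hg.nonneg p)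
    rw [Real.norm_of_nonneg (klFun_nonneg (by linarith [hf.nonneg p, hg.nonneg p]))]
    simp only [Pi.add_apply]
    linarith [sq_nonneg (√(f p) - √(g p))]

end IsAdmissibleDensity

lemma isCoupling_of_tendsto_sqrt {f : ℕ → ℝ × ℝ → ℝ} {h : ℝ × ℝ → ℝ}
    (hf : ∀ n, IsAdmissibleDensity μ ν (f n)) (hm : Measurable h)
    (hlim : Tendsto (fun n => eLpNorm ((fun p => √(f n p)) - h) 2 (μ.prod ν)) atTop (𝓝 0)) :
    IsCoupling (densityMeasure μ ν fun p => h p ^ 2) μ ν := by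
  have key {A : Set (ℝ × ℝ)} {C : ℝ≥0∞} (hA : MeasurableSet A)
      (hC : ∀ n, densityMeasure μ ν (f n) A = C) :
      densityMeasure μ ν (fun p => h p ^ 2) A = C := by
    rw [densityMeasure, withDensity_apply _ hA]
    refine lintegral_sq_eq_of_tendsto_eLpNorm (h := fun n p => √(f n p))
      (fun n => (hf n).measurable.sqrt.aestronglyMeasurable) hm.aestronglyMeasurable
      (fun n => ?_) ?_
    · rw [← hC n, densityMeasure, withDensity_apply _ hA]
      simp [Real.sq_sqrt ((hf n).nonneg _)]
    · exact tendsto_of_tendsto_of_tendsto_of_le_of_le tendsto_const_nhds hlim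
        (fun _ => zero_le) fun n => eLpNorm_mono_measure _ Measure.restrict_le_self
  exact isCoupling_iff.2
    ⟨fun A hA => key (measurable_fst hA) fun n => (isCoupling_iff.1 (hf n).isCoupling).1 A hA,
      fun A hA => key (measurable_snd hA) fun n => (isCoupling_iff.1 (hf n).isCoupling).2 A hA⟩

/-- Lower semicontinuity of the objective along a sequence of admissible densities. -/
lemma isAdmissibleDensity_and_densityObj_le_of_tendsto {f : ℕ → ℝ × ℝ → ℝ} {g : ℝ × ℝ → ℝ}
    (hf : ∀ n, IsAdmissibleDensity μ ν (f n)) (hg : Measurable g) (hg0 : ∀ p, 0 ≤ g p)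
    (hgc : IsCoupling (densityMeasure μ ν g) μ ν)
    (hμ2 : Integrable (fun y => y ^ 2) μ) (hν2 : Integrable (fun y => y ^ 2) ν)
    {ε I : ℝ} (hε : 0 < ε) (hI : Tendsto (fun n => densityObj μ ν ε (f n)) atTop (𝓝 I))
    (hlim : ∀ᵐ p ∂(μ.prod ν), Tendsto (fun n => f n p) atTop (𝓝 (g p))) :
    IsAdmissibleDensity μ ν g ∧ densityObj μ ν ε g ≤ I := by
  let F : (ℝ × ℝ → ℝ) → ℝ × ℝ → ℝ := fun f p => f p * (p.1 - p.2) ^ 2 + ε * klFun (f p)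
  have hF0 {f : ℝ × ℝ → ℝ} (hf0 : ∀ p, 0 ≤ f p) (p : ℝ × ℝ) : 0 ≤ F f p :=
    add_nonneg (mul_nonneg (hf0 p) (sq_nonneg _)) (mul_nonneg hε.le (klFun_nonneg (hf0 p)))
  have hFm {f : ℝ × ℝ → ℝ} (hfm : Measurable f) : Measurable (F f) :=
    (by fun_prop : Measurable fun p : ℝ × ℝ => f p * (p.1 - p.2) ^ 2).add
      ((measurable_klFun.comp hfm).const_mul ε)
  have hI0 : 0 ≤ I := ge_of_tendsto' hI fun n => (hf n).densityObj_nonneg hε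
  have hfatou : ∫⁻ p, ENNReal.ofReal (F g p) ∂(μ.prod ν) ≤ ENNReal.ofReal I := by
    calc ∫⁻ p, ENNReal.ofReal (F g p) ∂(μ.prod ν)
        = ∫⁻ p, liminf (fun n => ENNReal.ofReal (F (f n) p)) atTop ∂(μ.prod ν) := by
          refine lintegral_congr_ae ?_
          filter_upwards [hlim] with p hp
          refine (Tendsto.liminf_eq ((ENNReal.continuous_ofReal.tendsto _).comp ?_)).symm
          exact (hp.mul_const _).add (((continuous_klFun.tendsto _).comp hp).const_mul ε)
      _ ≤ liminf (fun n => ∫⁻ p, ENNReal.ofReal (F (f n) p) ∂(μ.prod ν)) atTop :=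
          lintegral_liminf_le fun n => (hFm (hf n).measurable).ennreal_ofReal
      _ = liminf (fun n => ENNReal.ofReal (densityObj μ ν ε (f n))) atTop := by
          congr 1 with n
          exact (ofReal_integral_eq_lintegral_ofReal ((hf n).integrable_obj hμ2 hν2 ε)
            (.of_forall (hF0 (hf n).nonneg))).symm
      _ = ENNReal.ofReal I :=
          ((ENNReal.continuous_ofReal.tendsto _).comp hI).liminf_eq
  have hint : Integrable (F g) (μ.prod ν) :=
    ⟨(hFm hg).aestronglyMeasurable, (hasFiniteIntegral_iff_ofReal (.of_forall (hF0 hg0))).2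
      (hfatou.trans_lt ENNReal.ofReal_lt_top)⟩
  refine ⟨⟨hg, hg0, hgc, ?_⟩, ?_⟩
  · refine (hint.const_mul ε⁻¹).mono' (measurable_klFun.comp hg).aestronglyMeasurable
      (.of_forall fun p => ?_)
    rw [Real.norm_of_nonneg (klFun_nonneg (hg0 p)), le_inv_mul_iff₀ hε]
    exact le_add_of_nonneg_left (mul_nonneg (hg0 p) (sq_nonneg _))
  · rw [← ofReal_integral_eq_lintegral_ofReal hint (.of_forall (hF0 hg0))] at hfatou
    exact (ENNReal.ofReal_le_ofReal_iff hI0).1 hfatou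

variable [IsProbabilityMeasure μ] [IsProbabilityMeasure ν]

lemma Admissible.exists_density {π : Measure (ℝ × ℝ)} (h : Admissible π μ ν) :
    ∃ f, IsAdmissibleDensity μ ν f ∧ densityMeasure μ ν f = π := by
  have := h.1.isProbabilityMeasure
  have heq : densityMeasure μ ν (fun p => (π.rnDeriv (μ.prod ν) p).toReal) = π := by
    conv_rhs => rw [← Measure.withDensity_rnDeriv_eq _ _ h.2.1]
    refine withDensity_congr_ae ?_
    filter_upwards [π.rnDeriv_lt_top (μ.prod ν)] with p hp
    exact ENNReal.ofReal_toReal hp.ne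
  refine ⟨_, ⟨(Measure.measurable_rnDeriv _ _).ennreal_toReal, fun _ => ENNReal.toReal_nonneg,
    heq.symm ▸ h.1, (integrable_klFun_rnDeriv_iff h.2.1).2 h.2.2⟩, heq⟩

namespace IsAdmissibleDensity

variable {f g : ℝ × ℝ → ℝ}

lemma rnDeriv_toReal_ae_eq (hf : IsAdmissibleDensity μ ν f) :
    (fun p => ((densityMeasure μ ν f).rnDeriv (μ.prod ν) p).toReal) =ᵐ[μ.prod ν] f := by
  filter_upwards [Measure.rnDeriv_withDensity (μ.prod ν) hf.measurable.ennreal_ofReal] with p hp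
  rw [densityMeasure, hp, ENNReal.toReal_ofReal (hf.nonneg p)]

lemma admissible (hf : IsAdmissibleDensity μ ν f) : Admissible (densityMeasure μ ν f) μ ν := by
  have := hf.isCoupling.isProbabilityMeasure
  have hac : densityMeasure μ ν f ≪ μ.prod ν := withDensity_absolutelyContinuous _ _
  refine ⟨hf.isCoupling, hac, (integrable_klFun_rnDeriv_iff hac).1 ?_⟩
  refine hf.integrable_klFun.congr ?_
  filter_upwards [hf.rnDeriv_toReal_ae_eq] with p hp
  rw [hp]

lemma integrable (hf : IsAdmissibleDensity μ ν f) : Integrable f (μ.prod ν) := by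
  have := hf.isCoupling.isProbabilityMeasure
  exact Measure.integrable_toReal_rnDeriv.congr hf.rnDeriv_toReal_ae_eq

lemma eotObj_eq (hf : IsAdmissibleDensity μ ν f)
    (hμ2 : Integrable (fun y => y ^ 2) μ) (hν2 : Integrable (fun y => y ^ 2) ν) (ε : ℝ) :
    eotObj μ ν ε (densityMeasure μ ν f) = densityObj μ ν ε f := by
  have := hf.isCoupling.isProbabilityMeasure
  have hadm := hf.admissible
  have hcost : ∫ p, (p.1 - p.2) ^ 2 ∂(densityMeasure μ ν f)
      = ∫ p, f p * (p.1 - p.2) ^ 2 ∂(μ.prod ν) := by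
    rw [densityMeasure, integral_withDensity_eq_integral_toReal_smul₀
      hf.measurable.ennreal_ofReal.aemeasurable (.of_forall fun _ => ENNReal.ofReal_lt_top)]
    simp [ENNReal.toReal_ofReal (hf.nonneg _)]
  have hent : ∫ p, klFun (f p) ∂(μ.prod ν) = relEnt (densityMeasure μ ν f) (μ.prod ν) := by
    have h := integral_klFun_rnDeriv hadm.2.1 hadm.2.2
    simp only [probReal_univ, add_sub_cancel_right] at h
    rw [relEnt, ← h]
    refine integral_congr_ae ?_
    filter_upwards [hf.rnDeriv_toReal_ae_eq] with p hp
    rw [hp]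
  rw [eotObj, densityObj, integral_add (hf.integrable_cost hμ2 hν2)
    (hf.integrable_klFun.const_mul ε), integral_const_mul, hcost, hent]

lemma one : IsAdmissibleDensity μ ν fun _ => 1 := by
  refine ⟨measurable_const, fun _ => zero_le_one, ?_, by simp [klFun_one]⟩
  simp only [densityMeasure, ENNReal.ofReal_one]
  rw [show (fun _ : ℝ × ℝ => (1 : ℝ≥0∞)) = 1 from rfl, withDensity_one]
  exact ⟨by simp, by simp⟩

lemma memLp_sqrt (hf : IsAdmissibleDensity μ ν f) :
    MemLp (fun p => √(f p)) 2 (μ.prod ν) := by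
  rw [memLp_two_iff_integrable_sq hf.measurable.sqrt.aestronglyMeasurable]
  exact hf.integrable.congr (.of_forall fun p => (Real.sq_sqrt (hf.nonneg p)).symm)

lemma integrable_sq_sqrt_sub (hf : IsAdmissibleDensity μ ν f) (hg : IsAdmissibleDensity μ ν g) :
    Integrable (fun p => (√(f p) - √(g p)) ^ 2) (μ.prod ν) :=
  (hf.memLp_sqrt.sub hg.memLp_sqrt).integrable_sq

/-- Quantitative strict convexity of the objective. -/
lemma densityObj_midpoint_add_le (hf : IsAdmissibleDensity μ ν f)
    (hg : IsAdmissibleDensity μ ν g)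
    (hμ2 : Integrable (fun y => y ^ 2) μ) (hν2 : Integrable (fun y => y ^ 2) ν)
    {ε : ℝ} (hε : 0 < ε) :
    densityObj μ ν ε (fun p => (f p + g p) / 2)
        + ε / 4 * ∫ p, (√(f p) - √(g p)) ^ 2 ∂(μ.prod ν)
      ≤ (densityObj μ ν ε f + densityObj μ ν ε g) / 2 := by
  have hi := (hf.midpoint hg).integrable_obj hμ2 hν2 ε
  have hf' := hf.integrable_obj hμ2 hν2 ε
  have hg' := hg.integrable_obj hμ2 hν2 ε
  have hd := (hf.integrable_sq_sqrt_sub hg).const_mul (ε / 4)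
  simp only [densityObj]
  rw [← integral_const_mul, ← integral_add hi hd, ← integral_add hf' hg', ← integral_div]
  refine integral_mono (hi.add hd) ((hf'.add hg').div_const 2) fun p => ?_
  have := mul_le_mul_of_nonneg_left (klFun_midpoint_add_sq_le (hf.nonneg p) (hg.nonneg p)) hε.le
  simp only
  linarith

/-- Densities that are almost optimal are close in Hellinger distance. -/
lemma integral_sq_sqrt_sub_lt (hf : IsAdmissibleDensity μ ν f)
    (hg : IsAdmissibleDensity μ ν g)
    (hμ2 : Integrable (fun y => y ^ 2) μ) (hν2 : Integrable (fun y => y ^ 2) ν)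
    {ε I δ : ℝ} (hε : 0 < ε) (hI : ∀ h, IsAdmissibleDensity μ ν h → I ≤ densityObj μ ν ε h)
    (hfI : densityObj μ ν ε f < I + ε / 4 * δ) (hgI : densityObj μ ν ε g < I + ε / 4 * δ) :
    ∫ p, (√(f p) - √(g p)) ^ 2 ∂(μ.prod ν) < δ := by
  have h1 := hf.densityObj_midpoint_add_le hg hμ2 hν2 hε
  have h2 := hI _ (hf.midpoint hg)
  exact lt_of_mul_lt_mul_left (by linarith) (show 0 ≤ ε / 4 by positivity)

lemma densityMeasure_eq_of_minimal (hf : IsAdmissibleDensity μ ν f)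
    (hg : IsAdmissibleDensity μ ν g)
    (hμ2 : Integrable (fun y => y ^ 2) μ) (hν2 : Integrable (fun y => y ^ 2) ν)
    {ε : ℝ} (hε : 0 < ε)
    (hfmin : ∀ h, IsAdmissibleDensity μ ν h → densityObj μ ν ε f ≤ densityObj μ ν ε h)
    (hgmin : ∀ h, IsAdmissibleDensity μ ν h → densityObj μ ν ε g ≤ densityObj μ ν ε h) :
    densityMeasure μ ν f = densityMeasure μ ν g := by
  have hfg := le_antisymm (hfmin g hg) (hgmin f hf)
  have hle : ∫ p, (√(f p) - √(g p)) ^ 2 ∂(μ.prod ν) ≤ 0 := by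
    refine le_of_forall_pos_lt_add fun δ hδ => ?_
    rw [zero_add]
    have : 0 < ε / 4 * δ := by positivity
    exact hf.integral_sq_sqrt_sub_lt hg hμ2 hν2 hε hfmin (by linarith) (by linarith)
  have hzero := (integral_eq_zero_iff_of_nonneg (fun p => sq_nonneg (√(f p) - √(g p)))
    (hf.integrable_sq_sqrt_sub hg)).1 (le_antisymm hle (integral_nonneg fun p => sq_nonneg _))
  refine withDensity_congr_ae ?_
  filter_upwards [hzero] with p hp
  have : √(f p) = √(g p) := sub_eq_zero.1 (pow_eq_zero_iff two_ne_zero |>.1 hp)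
  rw [(Real.sqrt_inj (hf.nonneg p) (hg.nonneg p)).1 this]

end IsAdmissibleDensity

lemma exists_minimal_density
    (hμ2 : Integrable (fun y => y ^ 2) μ) (hν2 : Integrable (fun y => y ^ 2) ν)
    {ε : ℝ} (hε : 0 < ε) :
    ∃ g, IsAdmissibleDensity μ ν g ∧
      ∀ h, IsAdmissibleDensity μ ν h → densityObj μ ν ε g ≤ densityObj μ ν ε h := by
  let S : Set ℝ := densityObj μ ν ε '' {f | IsAdmissibleDensity μ ν f}
  have hS : S.Nonempty := ⟨_, _, IsAdmissibleDensity.one, rfl⟩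
  have hSb : BddBelow S := by
    refine ⟨0, ?_⟩
    rintro _ ⟨f, hf, rfl⟩
    exact IsAdmissibleDensity.densityObj_nonneg hf hε
  have hinf (h) (hh : IsAdmissibleDensity μ ν h) : sInf S ≤ densityObj μ ν ε h :=
    csInf_le hSb ⟨h, hh, rfl⟩
  have happrox (n : ℕ) : ∃ f, IsAdmissibleDensity μ ν f ∧
      densityObj μ ν ε f < sInf S + ε / 4 * ((1 / 2) ^ n) ^ 2 := by
    obtain ⟨_, ⟨f, hf, rfl⟩, hlt⟩ := exists_lt_of_csInf_lt hS
      (lt_add_of_pos_right (sInf S) (show 0 < ε / 4 * ((1 / 2 : ℝ) ^ n) ^ 2 by positivity))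
    exact ⟨f, hf, hlt⟩
  choose f hf hfI using happrox
  have hpow {N n : ℕ} (hn : N ≤ n) :
      densityObj μ ν ε (f n) < sInf S + ε / 4 * ((1 / 2) ^ N) ^ 2 := by
    refine (hfI n).trans_le ?_
    have := pow_le_pow_of_le_one (a := (1 / 2 : ℝ)) (by norm_num) (by norm_num) hn
    gcongr sInf S + ε / 4 * ?_ ^ 2
  have hobj : Tendsto (fun n => densityObj μ ν ε (f n)) atTop (𝓝 (sInf S)) := by
    refine tendsto_of_tendsto_of_tendsto_of_le_of_le tendsto_const_nhds ?_
      (fun n => hinf _ (hf n)) fun n => (hfI n).le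
    have := tendsto_pow_atTop_nhds_zero_of_lt_one (r := (1 / 2 : ℝ)) (by norm_num) (by norm_num)
    simpa using ((this.pow 2).const_mul (ε / 4)).const_add (sInf S)
  have hB : ∑' n, ENNReal.ofReal ((1 / 2) ^ n) ≠ ∞ := by
    rw [← ENNReal.ofReal_tsum_of_nonneg (fun n => by positivity) summable_geometric_two]
    exact ENNReal.ofReal_ne_top
  obtain ⟨h₀, hh₀, hlim₀⟩ := Lp.cauchy_complete_eLpNorm (f := fun n p => √(f n p)) one_le_two
    (fun n => (hf n).memLp_sqrt) hB fun N n m hn hm => by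
      have hlt := (hf n).integral_sq_sqrt_sub_lt (hf m) hμ2 hν2 hε hinf (hpow hn) (hpow hm)
      refine (ENNReal.pow_lt_pow_left_iff two_ne_zero).1 ?_
      rw [eLpNorm_two_sq, ← ENNReal.ofReal_pow (by positivity)]
      simp only [Pi.sub_apply]
      rw [← ofReal_integral_eq_lintegral_ofReal ((hf n).integrable_sq_sqrt_sub (hf m))
        (.of_forall fun p => sq_nonneg _)]
      exact (ENNReal.ofReal_lt_ofReal_iff (by positivity)).2 hlt
  obtain ⟨h, hhm, hhae⟩ := hh₀.1.aemeasurable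
  have hlim : Tendsto (fun n => eLpNorm ((fun p => √(f n p)) - h) 2 (μ.prod ν)) atTop (𝓝 0) := by
    refine hlim₀.congr fun n => eLpNorm_congr_ae ?_
    filter_upwards [hhae] with p hp
    simp [hp]
  obtain ⟨ns, hns, hae⟩ := (tendstoInMeasure_of_tendsto_eLpNorm two_ne_zero
    (fun n => (hf n).measurable.sqrt.aestronglyMeasurable) hhm.aestronglyMeasurable
    hlim).exists_seq_tendsto_ae
  obtain ⟨hadm, hle⟩ := isAdmissibleDensity_and_densityObj_le_of_tendsto (g := fun p => h p ^ 2)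
    (fun n => hf (ns n)) (hhm.pow_const 2) (fun p => sq_nonneg _)
    (isCoupling_of_tendsto_sqrt hf hhm hlim) hμ2 hν2 hε (hobj.comp hns.tendsto_atTop) (by
      filter_upwards [hae] with p hp
      simpa only [Real.sq_sqrt ((hf _).nonneg _)] using hp.pow 2)
  exact ⟨_, hadm, fun h' hh' => hle.trans (hinf h' hh')⟩

end

/-- The entropic optimal transport problem admits a unique minimizer. -/
theorem eot_exists_unique_minimizer (μ ν : Measure ℝ)
    [IsProbabilityMeasure μ] [IsProbabilityMeasure ν]
    (hμ2 : Integrable (fun y => y ^ 2) μ) (hν2 : Integrable (fun y => y ^ 2) ν)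
    (ε : ℝ) (hε : 0 < ε) :
    ∃! π : Measure (ℝ × ℝ), Admissible π μ ν ∧
      ∀ π' : Measure (ℝ × ℝ), Admissible π' μ ν → eotObj μ ν ε π ≤ eotObj μ ν ε π' := by
  obtain ⟨f, hf, hfmin⟩ := exists_minimal_density hμ2 hν2 hε
  refine ⟨densityMeasure μ ν f, ⟨hf.admissible, fun π' hπ' => ?_⟩, ?_⟩
  · obtain ⟨g, hg, rfl⟩ := hπ'.exists_density
    rw [hf.eotObj_eq hμ2 hν2, hg.eotObj_eq hμ2 hν2]
    exact hfmin g hg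
  · rintro π ⟨hπ, hπmin⟩
    obtain ⟨g, hg, rfl⟩ := hπ.exists_density
    refine hg.densityMeasure_eq_of_minimal hf hμ2 hν2 hε (fun h hh => ?_) hfmin
    rw [← hg.eotObj_eq hμ2 hν2, ← hh.eotObj_eq hμ2 hν2]
    exact hπmin _ hh.admissible
end

section
/- Let μ be a probability measure on ℝ and let N_σ denote the centered Gaussian measure with variance σ². Then the smoothed Wasserstein distance σ ↦ W₂(μ ∗ N_σ, ν ∗ N_σ) is monotonically non-increasing in σ ≥ 0 and satisfies W₂(μ ∗ N_σ, ν ∗ N_σ) ≤ W₂(μ, ν) for all σ ≥ 0. -/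
open MeasureTheory Set ProbabilityTheory
open scoped NNReal

/-- The squared 2-Wasserstein distance between measures on `ℝ`. -/
noncomputable def W2sq (μ ν : Measure ℝ) : ℝ :=
  sInf {r | ∃ π : Measure (ℝ × ℝ), IsCoupling π μ ν ∧ r = ∫ p, (p.1 - p.2) ^ 2 ∂π}

/-- The 2-Wasserstein distance between measures on `ℝ`. -/
noncomputable def W2 (μ ν : Measure ℝ) : ℝ := Real.sqrt (W2sq μ ν)

/-- The centered Gaussian measure on `ℝ` with standard deviation `σ`. -/
noncomputable def gaussNoise (σ : ℝ≥0) : Measure ℝ := gaussianReal 0 (σ ^ 2)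

/-- Adding the same independent noise to both coordinates of a coupling of `μ` and `ν` gives a
coupling of the convolutions with the law of the noise. -/
lemma IsCoupling.conv {π : Measure (ℝ × ℝ)} {μ ν : Measure ℝ} [SFinite π] (h : IsCoupling π μ ν)
    (γ : Measure ℝ) [SFinite γ] :
    IsCoupling ((π.prod γ).map fun q => (q.1.1 + q.2, q.1.2 + q.2)) (μ.conv γ) (ν.conv γ) := by
  obtain ⟨rfl, rfl⟩ := h
  constructor
  · rw [Measure.map_map (by fun_prop) (by fun_prop), Measure.conv]
    nth_rewrite 2 [← Measure.map_id (μ := γ)]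
    rw [Measure.map_prod_map _ _ (by fun_prop) (by fun_prop),
      Measure.map_map (by fun_prop) (by fun_prop)]
    rfl
  · rw [Measure.map_map (by fun_prop) (by fun_prop), Measure.conv]
    nth_rewrite 2 [← Measure.map_id (μ := γ)]
    rw [Measure.map_prod_map _ _ (by fun_prop) (by fun_prop),
      Measure.map_map (by fun_prop) (by fun_prop)]
    rfl

/-- Convolving both measures with the same probability measure does not increase their
Wasserstein distance. -/
lemma W2_conv_le (μ ν γ : Measure ℝ) [IsProbabilityMeasure μ] [IsProbabilityMeasure ν]
    [IsProbabilityMeasure γ] : W2 (μ.conv γ) (ν.conv γ) ≤ W2 μ ν := by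
  refine Real.sqrt_le_sqrt (csInf_le_csInf ?_ ?_ ?_)
  · refine ⟨0, ?_⟩
    rintro _ ⟨π, -, rfl⟩
    exact integral_nonneg fun p => sq_nonneg _
  · exact ⟨_, μ.prod ν, ⟨by simp, by simp⟩, rfl⟩
  · rintro _ ⟨π, hπ, rfl⟩
    have : IsProbabilityMeasure (π.map Prod.fst) := by rw [hπ.1]; infer_instance
    have : IsProbabilityMeasure π :=
      Measure.isProbabilityMeasure_of_map Prod.fst
    refine ⟨_, hπ.conv γ, ?_⟩
    rw [integral_map (by fun_prop) (by fun_prop)]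
    simp only [add_sub_add_right_eq_sub]
    rw [integral_fun_fst (μ := π) (ν := γ) (fun p : ℝ × ℝ => (p.1 - p.2) ^ 2)]
    simp

instance (σ : ℝ≥0) : IsProbabilityMeasure (gaussNoise σ) :=
  inferInstanceAs (IsProbabilityMeasure (gaussianReal 0 (σ ^ 2)))

lemma exists_gaussNoise_conv_eq {σ₁ σ₂ : ℝ≥0} (h : σ₁ ≤ σ₂) :
    ∃ γ : Measure ℝ, IsProbabilityMeasure γ ∧ (gaussNoise σ₁).conv γ = gaussNoise σ₂ := by
  refine ⟨gaussianReal 0 (σ₂ ^ 2 - σ₁ ^ 2), inferInstance, ?_⟩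
  rw [gaussNoise, gaussNoise, gaussianReal_conv_gaussianReal, add_zero,
    add_tsub_cancel_of_le (by gcongr)]

/-- The Gaussian-smoothed 2-Wasserstein distance `σ ↦ W₂(μ ∗ N_σ, ν ∗ N_σ)` is
monotonically non-increasing in `σ` and bounded above by `W₂(μ, ν)`. -/
theorem smoothed_wasserstein_mono (μ ν : Measure ℝ)
    [IsProbabilityMeasure μ] [IsProbabilityMeasure ν]
    (hμ2 : Integrable (fun y => y ^ 2) μ) (hν2 : Integrable (fun y => y ^ 2) ν) :
    (∀ σ₁ σ₂ : ℝ≥0, σ₁ ≤ σ₂ →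
      W2 (μ.conv (gaussNoise σ₂)) (ν.conv (gaussNoise σ₂)) ≤
        W2 (μ.conv (gaussNoise σ₁)) (ν.conv (gaussNoise σ₁))) ∧
    (∀ σ : ℝ≥0, W2 (μ.conv (gaussNoise σ)) (ν.conv (gaussNoise σ)) ≤ W2 μ ν) := by
  refine ⟨fun σ₁ σ₂ h => ?_, fun σ => W2_conv_le μ ν _⟩
  obtain ⟨γ, hγ, hconv⟩ := exists_gaussNoise_conv_eq h
  rw [← hconv, ← Measure.conv_assoc, ← Measure.conv_assoc]
  exact W2_conv_le _ _ γ
end
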